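/- arXiv:1907.07542 — 2 statements merged into one kernel-verified Lean document; each statement's English description precedes it below -/
import Mathlib

section
/- Let n ≥ 1, K > 0, and let L : ℝ × ℝⁿ × ℝⁿ × ℝ → ℝ be C¹ with |∂L/∂u| ≤ K everywhere and with u ↦ L(s,x,v,u) concave for every (s,x,v). Fix t₁ < t₂, x, y ∈ ℝⁿ and u₀ ∈ ℝ, and suppose ξ* ∈ Γ^{t₁,t₂}_{x,y} is a minimizer for h_L(t₁,t₂,x,y,u₀), i.e. ξ* attains the infimum in its definition; let u_{ξ*} be the corresponding Carathéodory solution with u_{ξ*}(t₁) = u₀. Define the linearized Lagrangian L^{ξ*}(s,x,v,u) := L(s,x,v,u_{ξ*}(s)) + (∂L/∂u)(s,x,v,u_{ξ*}(s))·(u − u_{ξ*}(s)). Then h_L(t₁,t₂,x,y,u₀) = h_{L^{ξ*}}(t₁,t₂,x,y,u₀). -/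
open MeasureTheory Set

noncomputable section

/-- A Lipschitz curve `ξ : [a,b] → ℝⁿ`, with `ξ'` its a.e. derivative. -/
def IsLipCurve (n : ℕ) (a b : ℝ) (ξ ξ' : ℝ → EuclideanSpace ℝ (Fin n)) : Prop :=
  (∃ C : NNReal, LipschitzOnWith C ξ (Icc a b)) ∧
  IntervalIntegrable ξ' volume a b ∧
  ∀ s ∈ Icc a b, ξ s = ξ a + ∫ τ in a..s, ξ' τ

/-- `w` is the Carathéodory solution on `[a,b]` along `(ξ,ξ')` with initial value `u₀`. -/
def IsCaraSol (n : ℕ) (L : ℝ → EuclideanSpace ℝ (Fin n) → EuclideanSpace ℝ (Fin n) → ℝ → ℝ)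
    (a b : ℝ) (ξ ξ' : ℝ → EuclideanSpace ℝ (Fin n)) (u₀ : ℝ) (w : ℝ → ℝ) : Prop :=
  ContinuousOn w (Icc a b) ∧
  IntervalIntegrable (fun τ => L τ (ξ τ) (ξ' τ) (w τ)) volume a b ∧
  ∀ s ∈ Icc a b, w s = u₀ + ∫ τ in a..s, L τ (ξ τ) (ξ' τ) (w τ)

/-- A primitive `d` of `g` which vanishes at `a` and satisfies `K * d ≤ g` wherever `d < 0` is
nonnegative. -/
lemma nonneg_of_eq_integral_of_mul_le {a b K : ℝ} {d g : ℝ → ℝ}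
    (hd : ContinuousOn d (Icc a b)) (hg : IntervalIntegrable g volume a b)
    (hdg : ∀ s ∈ Icc a b, d s = ∫ τ in a..s, g τ)
    (hle : ∀ s ∈ Icc a b, d s < 0 → K * d s ≤ g s) :
    ∀ s ∈ Icc a b, 0 ≤ d s := by
  intro s hs
  by_contra! hneg
  have hab : a ≤ b := hs.1.trans hs.2
  have hsub : Icc a s ⊆ Icc a b := Icc_subset_Icc_right hs.2
  have hcpt : IsCompact (Icc a s ∩ d ⁻¹' Ici 0) :=
    isCompact_Icc.of_isClosed_subset
      ((hd.mono hsub).preimage_isClosed_of_isClosed isClosed_Icc isClosed_Ici) inter_subset_left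
  have hda : d a = 0 := by simpa using hdg a (left_mem_Icc.2 hab)
  obtain ⟨r, ⟨hr, hdr⟩, hmax⟩ := hcpt.exists_isGreatest ⟨a, left_mem_Icc.2 hs.1, hda.ge⟩
  replace hdr : 0 ≤ d r := hdr
  have hrI : r ∈ Icc a b := hsub hr
  have hd_neg : ∀ t ∈ Ioc r s, d t < 0 := fun t ht => by
    by_contra! h
    exact ht.1.not_ge (hmax ⟨⟨hr.1.trans ht.1.le, ht.2⟩, h⟩)
  let e : ℝ → ℝ := fun t => max (-d (projIcc a b hab t)) 0
  have he : Continuous e :=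
    ((hd.domRestrict.comp continuous_projIcc).neg).max continuous_const
  have he_eq : ∀ t ∈ Icc a b, e t = max (-d t) 0 := fun t ht => by
    simp only [e, projIcc_of_mem hab ht]
  have he_neg : ∀ t ∈ Ioc r s, e t = -d t := fun t ht => by
    rw [he_eq t ⟨hr.1.trans ht.1.le, ht.2.trans hs.2⟩, max_eq_left (by linarith [hd_neg t ht])]
  have hbound : ∀ t ∈ Icc r s, e t ≤ K * ∫ τ in r..t, e τ := by
    intro t ht
    rcases ht.1.eq_or_lt with rfl | hrt
    · rw [he_eq r hrI]
      simpa using hdr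
    · have htI : t ∈ Icc a b := ⟨hr.1.trans ht.1, ht.2.trans hs.2⟩
      have hgat : IntervalIntegrable g volume a t :=
        hg.mono_set (by rw [uIcc_of_le hab, uIcc_of_le htI.1]; exact Icc_subset_Icc_right htI.2)
      have hgar : IntervalIntegrable g volume a r :=
        hg.mono_set (by rw [uIcc_of_le hab, uIcc_of_le hrI.1]; exact Icc_subset_Icc_right hrI.2)
      have hgrt : IntervalIntegrable g volume r t := hgar.symm.trans hgat
      have hadd := intervalIntegral.integral_add_adjacent_intervals hgar hgrt
      have hmono : ∫ τ in r..t, -(K * e τ) ≤ ∫ τ in r..t, g τ := by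
        refine intervalIntegral.integral_mono_on_of_le_Ioo ht.1
          ((continuous_const.mul he).neg.intervalIntegrable _ _) hgrt fun τ hτ => ?_
        have hτs : τ ∈ Ioc r s := ⟨hτ.1, hτ.2.le.trans ht.2⟩
        rw [he_neg τ hτs]
        linarith [hle τ ⟨hr.1.trans hτ.1.le, hτs.2.trans hs.2⟩ (hd_neg τ hτs)]
      rw [intervalIntegral.integral_neg, intervalIntegral.integral_const_mul] at hmono
      rw [he_neg t ⟨hrt, ht.2⟩]
      linarith [hdg t htI, hdg r hrI]
  have he_nonneg : ∀ t, 0 ≤ e t := fun t => le_max_right _ _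
  have hzero := eq_zero_of_abs_deriv_le_mul_abs_self_of_eq_zero_right (K := K)
    (f := fun t => ∫ τ in r..t, e τ) (f' := e) (a := r) (b := s)
    (intervalIntegral.continuous_primitive (fun _ _ => he.intervalIntegrable _ _) r).continuousOn
    (fun t _ => (he.integral_hasStrictDerivAt r t).hasDerivAt.hasDerivWithinAt)
    (by simp)
    (fun t ht => by
      rw [Real.norm_of_nonneg (he_nonneg t), Real.norm_of_nonneg
        (intervalIntegral.integral_nonneg ht.1 fun τ _ => he_nonneg τ)]
      exact hbound t ⟨ht.1, ht.2.le⟩)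
    s (right_mem_Icc.2 hr.2)
  have hrs : r < s := hr.2.lt_of_ne (by rintro rfl; exact hneg.not_ge hdr)
  have h := hbound s (right_mem_Icc.2 hr.2)
  rw [hzero, mul_zero, he_neg s ⟨hrs, le_rfl⟩] at h
  linarith

/-- Comparison principle for Carathéodory solutions. -/
lemma IsCaraSol.le_of_mul_sub_le {n : ℕ} {a b K u₀ : ℝ}
    {L M : ℝ → EuclideanSpace ℝ (Fin n) → EuclideanSpace ℝ (Fin n) → ℝ → ℝ}
    {ξ ξ' : ℝ → EuclideanSpace ℝ (Fin n)} {u v : ℝ → ℝ}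
    (hu : IsCaraSol n L a b ξ ξ' u₀ u) (hv : IsCaraSol n M a b ξ ξ' u₀ v)
    (hle : ∀ s ∈ Icc a b, v s < u s →
      K * (v s - u s) ≤ M s (ξ s) (ξ' s) (v s) - L s (ξ s) (ξ' s) (u s)) :
    ∀ s ∈ Icc a b, u s ≤ v s := by
  intro s hs
  have hab : a ≤ b := hs.1.trans hs.2
  refine sub_nonneg.1 (nonneg_of_eq_integral_of_mul_le (hv.1.sub hu.1) (hv.2.1.sub hu.2.1)
    (fun t ht => ?_) (fun t ht h => hle t ht (sub_neg.1 h)) s hs)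
  have hsub : uIcc a t ⊆ uIcc a b := by
    rw [uIcc_of_le hab, uIcc_of_le ht.1]
    exact Icc_subset_Icc_right ht.2
  rw [intervalIntegral.integral_sub (hv.2.1.mono_set hsub) (hu.2.1.mono_set hsub), Pi.sub_apply,
    hv.2.2 t ht, hu.2.2 t ht]
  ring

lemma IsCaraSol.integral_eq {n : ℕ} {a b u₀ : ℝ}
    {L : ℝ → EuclideanSpace ℝ (Fin n) → EuclideanSpace ℝ (Fin n) → ℝ → ℝ}
    {ξ ξ' : ℝ → EuclideanSpace ℝ (Fin n)} {u : ℝ → ℝ}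
    (hu : IsCaraSol n L a b ξ ξ' u₀ u) (hab : a ≤ b) :
    ∫ s in a..b, L s (ξ s) (ξ' s) (u s) = u b - u₀ := by
  rw [hu.2.2 b (right_mem_Icc.2 hab)]
  ring

/-- A concave function lies below its tangent lines. -/
lemma ConcaveOn.le_tangent {f : ℝ → ℝ} {f' x : ℝ} (hf : ConcaveOn ℝ univ f)
    (hf' : HasDerivAt f f' x) (y : ℝ) : f y ≤ f x + f' * (y - x) := by
  rcases lt_trichotomy x y with h | rfl | h
  · have := hf.slope_le_of_hasDerivAt (mem_univ _) (mem_univ _) h hf'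
    rw [slope_def_field, div_le_iff₀ (sub_pos.2 h)] at this
    linarith
  · simp
  · have := hf.le_slope_of_hasDerivAt (mem_univ _) (mem_univ _) h hf'
    rw [slope_def_field, le_div_iff₀ (sub_pos.2 h)] at this
    linarith

/-- **Proposition 2.5 (1)**: if `ξ*` is a minimizer for the negative-type fundamental solution
`h_L(t₁,t₂,x,y,u₀)` and `L^{ξ*}` is the Lagrangian linearized in `u` around `u_{ξ*}`, then
`h_L(t₁,t₂,x,y,u₀) = h_{L^{ξ*}}(t₁,t₂,x,y,u₀)` (as elements of `ℝ ∪ {−∞}`). -/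
theorem fundamental_solution_linearized_eq
    (n : ℕ) (hn : 1 ≤ n) (K : ℝ) (hK : 0 < K)
    (L Lu : ℝ → EuclideanSpace ℝ (Fin n) → EuclideanSpace ℝ (Fin n) → ℝ → ℝ)
    (hLC1 : ContDiff ℝ 1 fun p : ℝ × EuclideanSpace ℝ (Fin n) × EuclideanSpace ℝ (Fin n) × ℝ =>
      L p.1 p.2.1 p.2.2.1 p.2.2.2)
    (hLu : ∀ (s : ℝ) (x v : EuclideanSpace ℝ (Fin n)) (u : ℝ),
      HasDerivAt (fun r => L s x v r) (Lu s x v u) u)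
    (hLuK : ∀ (s : ℝ) (x v : EuclideanSpace ℝ (Fin n)) (u : ℝ), |Lu s x v u| ≤ K)
    (hconc : ∀ (s : ℝ) (x v : EuclideanSpace ℝ (Fin n)),
      ConcaveOn ℝ univ fun u : ℝ => L s x v u)
    (t₁ t₂ : ℝ) (ht : t₁ < t₂) (x y : EuclideanSpace ℝ (Fin n)) (u₀ : ℝ)
    (usol : (ℝ → EuclideanSpace ℝ (Fin n)) → (ℝ → EuclideanSpace ℝ (Fin n)) → ℝ → ℝ)
    (husol : ∀ ξ ξ', IsLipCurve n t₁ t₂ ξ ξ' → ξ t₁ = x → ξ t₂ = y →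
      IsCaraSol n L t₁ t₂ ξ ξ' u₀ (usol ξ ξ'))
    (ξs ξs' : ℝ → EuclideanSpace ℝ (Fin n))
    (hξs : IsLipCurve n t₁ t₂ ξs ξs' ∧ ξs t₁ = x ∧ ξs t₂ = y)
    (hmin : ∀ p : {p : (ℝ → EuclideanSpace ℝ (Fin n)) × (ℝ → EuclideanSpace ℝ (Fin n)) //
        IsLipCurve n t₁ t₂ p.1 p.2 ∧ p.1 t₁ = x ∧ p.1 t₂ = y},
      (∫ s in t₁..t₂, L s (ξs s) (ξs' s) (usol ξs ξs' s)) ≤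
        ∫ s in t₁..t₂, L s (p.1.1 s) (p.1.2 s) (usol p.1.1 p.1.2 s))
    (vsol : (ℝ → EuclideanSpace ℝ (Fin n)) → (ℝ → EuclideanSpace ℝ (Fin n)) → ℝ → ℝ)
    (hvsol : ∀ η η', IsLipCurve n t₁ t₂ η η' → η t₁ = x → η t₂ = y →
      IsCaraSol n (fun s z v u => L s z v (usol ξs ξs' s) +
          Lu s z v (usol ξs ξs' s) * (u - usol ξs ξs' s))
        t₁ t₂ η η' u₀ (vsol η η')) :
    (⨅ p : {p : (ℝ → EuclideanSpace ℝ (Fin n)) × (ℝ → EuclideanSpace ℝ (Fin n)) //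
        IsLipCurve n t₁ t₂ p.1 p.2 ∧ p.1 t₁ = x ∧ p.1 t₂ = y},
      (((∫ s in t₁..t₂, L s (p.1.1 s) (p.1.2 s) (usol p.1.1 p.1.2 s)) : ℝ) : EReal)) =
    ⨅ p : {p : (ℝ → EuclideanSpace ℝ (Fin n)) × (ℝ → EuclideanSpace ℝ (Fin n)) //
        IsLipCurve n t₁ t₂ p.1 p.2 ∧ p.1 t₁ = x ∧ p.1 t₂ = y},
      (((∫ s in t₁..t₂, (L s (p.1.1 s) (p.1.2 s) (usol ξs ξs' s) +
          Lu s (p.1.1 s) (p.1.2 s) (usol ξs ξs' s) *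
            (vsol p.1.1 p.1.2 s - usol ξs ξs' s))) : ℝ) : EReal) := by
  have hmul : ∀ s z v r c, c < 0 → K * c ≤ Lu s z v r * c := fun s z v r c hc =>
    mul_le_mul_of_nonpos_right (abs_le.1 (hLuK s z v r)).2 hc.le
  have hstar := husol ξs ξs' hξs.1 hξs.2.1 hξs.2.2
  have hvstar := hvsol ξs ξs' hξs.1 hξs.2.1 hξs.2.2
  apply le_antisymm
  · refine iInf_mono fun p => EReal.coe_le_coe_iff.2 ?_
    have hu := husol p.1.1 p.1.2 p.2.1 p.2.2.1 p.2.2.2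
    have hv := hvsol p.1.1 p.1.2 p.2.1 p.2.2.1 p.2.2.2
    rw [hu.integral_eq ht.le, hv.integral_eq ht.le]
    refine sub_le_sub_right (hu.le_of_mul_sub_le (K := K) hv (fun s _ h => ?_) t₂
      (right_mem_Icc.2 ht.le)) _
    have h₁ := (hconc s (p.1.1 s) (p.1.2 s)).le_tangent
      (hLu s (p.1.1 s) (p.1.2 s) (usol ξs ξs' s)) (usol p.1.1 p.1.2 s)
    have h₂ := hmul s (p.1.1 s) (p.1.2 s) (usol ξs ξs' s) _ (sub_neg.2 h)
    linarith
  · refine le_iInf fun p => (iInf_le _ ⟨(ξs, ξs'), hξs⟩).trans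
      (EReal.coe_le_coe_iff.2 (le_trans ?_ (hmin p)))
    rw [hstar.integral_eq ht.le, hvstar.integral_eq ht.le]
    refine sub_le_sub_right (hvstar.le_of_mul_sub_le (K := K) hstar (fun s _ h => ?_) t₂
      (right_mem_Icc.2 ht.le)) _
    have := hmul s (ξs s) (ξs' s) (usol ξs ξs' s) _ (sub_neg.2 h)
    linarith
end
end

section
/- Let n ≥ 1, K > 0, and let L : ℝ × ℝⁿ × ℝⁿ × ℝ → ℝ be C¹ with |∂L/∂u| ≤ K everywhere and with u ↦ L(s,x,v,u) concave for every (s,x,v). Let φ : ℝⁿ → ℝ, t > 0, x ∈ ℝⁿ, and define u(t,x) := inf over ξ ∈ A_{t,x} of u_ξ(t), where u_ξ is the Carathéodory solution on [0,t] with u_ξ(0) = φ(ξ(0)). Suppose ξ* ∈ A_{t,x} attains this infimum, and set y* := ξ*(0). Then u(t,x) = inf over η ∈ Γ^{0,t}_{y*,x} of ( exp(∫₀^{t} ℓ_η(τ) dτ)·φ(y*) + ∫₀^{t} exp(∫_{s}^{t} ℓ_η(τ) dτ)·( L(s,η(s),η'(s),u_{ξ*}(s)) − u_{ξ*}(s)·ℓ_η(s)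 ) ds ), where ℓ_η(s) := (∂L/∂u)(s,η(s),η'(s),u_{ξ*}(s)). In particular, the right-hand side does not depend on the choice of the minimizing curve ξ*. -/
open MeasureTheory Set

noncomputable section

/-- Post-composition with a Lipschitz function preserves absolute continuity. -/
theorem AbsolutelyContinuousOnInterval.lipschitzOnWith_comp {f g : ℝ → ℝ} {a b : ℝ}
    {C : NNReal} {s : Set ℝ} (hf : AbsolutelyContinuousOnInterval f a b)
    (hg : LipschitzOnWith C g s) (hfs : MapsTo f (uIcc a b) s) :
    AbsolutelyContinuousOnInterval (fun x => g (f x)) a b := by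
  rw [absolutelyContinuousOnInterval_iff] at hf ⊢
  intro ε hε
  obtain ⟨δ, hδ, h⟩ := hf (ε / (C + 1)) (by positivity)
  refine ⟨δ, hδ, fun E hE hEδ => ?_⟩
  calc ∑ i ∈ Finset.range E.1, dist (g (f (E.2 i).1)) (g (f (E.2 i).2))
      ≤ ∑ i ∈ Finset.range E.1, C * dist (f (E.2 i).1) (f (E.2 i).2) :=
        Finset.sum_le_sum fun i hi =>
          hg.dist_le_mul _ (hfs (hE.1 i hi).1) _ (hfs (hE.1 i hi).2)
    _ = C * ∑ i ∈ Finset.range E.1, dist (f (E.2 i).1) (f (E.2 i).2) := by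
        rw [Finset.mul_sum]
    _ ≤ C * (ε / (C + 1)) := by
        have := (h E hE hEδ).le
        gcongr
    _ < ε := by
        rw [← mul_div_assoc, div_lt_iff₀ (by positivity)]
        nlinarith

/-- The exponential of an absolutely continuous function is absolutely continuous. -/
theorem AbsolutelyContinuousOnInterval.exp {f : ℝ → ℝ} {a b : ℝ}
    (hf : AbsolutelyContinuousOnInterval f a b) :
    AbsolutelyContinuousOnInterval (fun x => Real.exp (f x)) a b := by
  obtain ⟨M, hM⟩ := hf.exists_bound
  obtain ⟨C, hC⟩ := (Real.contDiff_exp (n := 1)).contDiffOn.exists_lipschitzOnWith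
    one_ne_zero (convex_Icc (-M) M) isCompact_Icc
  exact hf.lipschitzOnWith_comp hC fun x hx => abs_le.mp (hM x hx)

/-- The primitive of an integrable function with respect to its lower limit is absolutely
continuous. -/
theorem absolutelyContinuousOnInterval_integral_left {f : ℝ → ℝ} {a b : ℝ}
    (hf : IntervalIntegrable f volume a b) :
    AbsolutelyContinuousOnInterval (fun s => ∫ τ in s..b, f τ) a b := by
  simpa only [intervalIntegral.integral_symm b, neg_neg, Pi.neg_def] using
    (hf.absolutelyContinuousOnInterval_intervalIntegral (right_mem_uIcc (a := a))).neg

/-- Variation of constants: a primitive `v` of `g`, viewed as a solution of the linear equation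
`v' = c v + (g - v c)`. -/
theorem eq_exp_mul_add_integral_exp_mul {c g v : ℝ → ℝ} {a b v₀ : ℝ} (hab : a ≤ b)
    (hc : IntervalIntegrable c volume a b) (hg : IntervalIntegrable g volume a b)
    (hv : ∀ s ∈ Icc a b, v s = v₀ + ∫ τ in a..s, g τ) :
    v b = Real.exp (∫ τ in a..b, c τ) * v₀ +
      ∫ s in a..b, Real.exp (∫ τ in s..b, c τ) * (g s - v s * c s) := by
  have hE := (absolutelyContinuousOnInterval_integral_left hc).exp
  have hV : AbsolutelyContinuousOnInterval (fun s => v₀ + ∫ τ in a..s, g τ) a b :=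
    (ContDiffOn.absolutelyContinuousOnInterval (contDiffOn_const (c := v₀))).add
      (hg.absolutelyContinuousOnInterval_intervalIntegral left_mem_uIcc)
  have key := hE.integral_deriv_mul_eq_sub hV
  have hcongr : ∫ s in a..b, Real.exp (∫ τ in s..b, c τ) * (g s - v s * c s) =
      ∫ s in a..b, deriv (fun s => Real.exp (∫ τ in s..b, c τ)) s * (v₀ + ∫ τ in a..s, g τ) +
        Real.exp (∫ τ in s..b, c τ) * deriv (fun s => v₀ + ∫ τ in a..s, g τ) s := by
    apply intervalIntegral.integral_congr_ae
    filter_upwards [hc.ae_hasDerivAt_integral, hg.ae_hasDerivAt_integral] with s hcs hgs hs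
    have hs' := uIoc_subset_uIcc hs
    have hd : HasDerivAt (fun s => ∫ τ in s..b, c τ) (-c s) s := by
      simpa only [intervalIntegral.integral_symm b, neg_neg, Pi.neg_def] using
        (hcs hs' b right_mem_uIcc).neg
    rw [hd.exp.deriv, ((hgs hs' a left_mem_uIcc).const_add v₀).deriv,
      hv s (uIcc_of_le hab ▸ hs')]
    ring
  rw [hcongr, key, hv b (right_mem_Icc.mpr hab)]
  simp

/-- A differentiable concave function lies below its tangents. -/
theorem ConcaveOn.le_add_mul_of_hasDerivAt {f : ℝ → ℝ} {f' p : ℝ} (hf : ConcaveOn ℝ univ f)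
    (hf' : HasDerivAt f f' p) (q : ℝ) : f q ≤ f p + f' * (q - p) := by
  rcases lt_trichotomy p q with h | rfl | h
  · have := hf.slope_le_of_hasDerivAt (mem_univ _) (mem_univ _) h hf'
    rw [slope_def_field, div_le_iff₀ (by linarith)] at this
    linarith
  · simp
  · have := hf.le_slope_of_hasDerivAt (mem_univ _) (mem_univ _) h hf'
    rw [slope_def_field, le_div_iff₀ (by linarith)] at this
    linarith

/-- The partial derivative in the last variable of a `C¹` function is continuous. -/
theorem continuous_partialDeriv_last {X : Type*} [NormedAddCommGroup X] [NormedSpace ℝ X]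
    {L Lu : ℝ → X → X → ℝ → ℝ}
    (hL : ContDiff ℝ 1 fun p : ℝ × X × X × ℝ => L p.1 p.2.1 p.2.2.1 p.2.2.2)
    (hLu : ∀ s x v u, HasDerivAt (fun r => L s x v r) (Lu s x v u) u) :
    Continuous fun p : ℝ × X × X × ℝ => Lu p.1 p.2.1 p.2.2.1 p.2.2.2 := by
  have h : (fun p : ℝ × X × X × ℝ => Lu p.1 p.2.1 p.2.2.1 p.2.2.2) = fun p =>
      fderiv ℝ (fun p : ℝ × X × X × ℝ => L p.1 p.2.1 p.2.2.1 p.2.2.2) p (0, 0, 0, 1) := by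
    funext p
    obtain ⟨s, x, v, u⟩ := p
    have hd := (hL.differentiable one_ne_zero (s, x, v, u)).hasFDerivAt
    have hι : HasDerivAt (fun r : ℝ => (s, x, v, r)) (0, 0, 0, 1) u :=
      (hasDerivAt_const u s).prodMk
        ((hasDerivAt_const u x).prodMk ((hasDerivAt_const u v).prodMk (hasDerivAt_id u)))
    have hcomp := hd.comp_hasDerivAt u hι
    exact (hLu s x v u).unique hcomp
  rw [h]
  exact (hL.continuous_fderiv one_ne_zero).clm_apply continuous_const

/-- A continuous function evaluated along a Lipschitz curve, its derivative and a continuous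
function of time is a.e. strongly measurable. -/
theorem IsLipCurve.aestronglyMeasurable_comp {n : ℕ} {a b : ℝ}
    {F : ℝ → EuclideanSpace ℝ (Fin n) → EuclideanSpace ℝ (Fin n) → ℝ → ℝ}
    (hF : Continuous fun p : ℝ × EuclideanSpace ℝ (Fin n) × EuclideanSpace ℝ (Fin n) × ℝ =>
      F p.1 p.2.1 p.2.2.1 p.2.2.2)
    {η η' : ℝ → EuclideanSpace ℝ (Fin n)} {w : ℝ → ℝ} (hab : a ≤ b)
    (hη : IsLipCurve n a b η η') (hw : ContinuousOn w (Icc a b)) :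
    AEStronglyMeasurable (fun s => F s (η s) (η' s) (w s)) (volume.restrict (uIoc a b)) := by
  obtain ⟨⟨C, hC⟩, hη', -⟩ := hη
  have hsub : uIoc a b ⊆ Icc a b := uIcc_of_le hab ▸ uIoc_subset_uIcc
  refine hF.comp_aestronglyMeasurable (aestronglyMeasurable_id.prodMk
    (((hC.continuousOn.mono hsub).aestronglyMeasurable measurableSet_uIoc).prodMk
      (AEStronglyMeasurable.prodMk ?_
        ((hw.mono hsub).aestronglyMeasurable measurableSet_uIoc))))
  exact (intervalIntegrable_iff.mp hη').aestronglyMeasurable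

/-- If `|∂F/∂u| ≤ K` and `F` is integrable along a Lipschitz curve for one continuous choice of
the last variable, then it is so for every continuous choice. -/
theorem IsLipCurve.intervalIntegrable_comp {n : ℕ} {a b K : ℝ}
    {F Fu : ℝ → EuclideanSpace ℝ (Fin n) → EuclideanSpace ℝ (Fin n) → ℝ → ℝ}
    (hF : Continuous fun p : ℝ × EuclideanSpace ℝ (Fin n) × EuclideanSpace ℝ (Fin n) × ℝ =>
      F p.1 p.2.1 p.2.2.1 p.2.2.2)
    (hFu : ∀ s x v u, HasDerivAt (fun r => F s x v r) (Fu s x v u) u)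
    (hK : ∀ s x v u, |Fu s x v u| ≤ K)
    {η η' : ℝ → EuclideanSpace ℝ (Fin n)} {w z : ℝ → ℝ} (hab : a ≤ b)
    (hη : IsLipCurve n a b η η') (hw : ContinuousOn w (Icc a b)) (hz : ContinuousOn z (Icc a b))
    (hFz : IntervalIntegrable (fun s => F s (η s) (η' s) (z s)) volume a b) :
    IntervalIntegrable (fun s => F s (η s) (η' s) (w s)) volume a b := by
  have hbound : IntervalIntegrable (fun s => K * |w s - z s|) volume a b := by
    apply ContinuousOn.intervalIntegrable
    rw [uIcc_of_le hab]
    exact continuousOn_const.mul (hw.sub hz).abs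
  refine (hFz.norm.add hbound).mono_fun (hη.aestronglyMeasurable_comp hF hab hw)
    (Filter.Eventually.of_forall fun s => ?_)
  have hlip := convex_univ.norm_image_sub_le_of_norm_hasDerivWithin_le
    (fun u _ => (hFu s (η s) (η' s) u).hasDerivWithinAt) (fun u _ => hK s (η s) (η' s) u)
    (mem_univ (z s)) (mem_univ (w s))
  refine le_trans ?_ (Real.le_norm_self _)
  have := norm_le_norm_add_norm_sub (F s (η s) (η' s) (z s)) (F s (η s) (η' s) (w s))
  rw [norm_sub_rev] at this
  simp only [Real.norm_eq_abs] at *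
  linarith

/-- **Representation formula III (Theorem 2.6)**: if `ξ*` is a minimizing curve for
`u(t,x) = inf_{ξ ∈ A_{t,x}} u_ξ(t)` with `y* = ξ*(0)`, then
`u(t,x) = inf_{η ∈ Γ^{0,t}_{y*,x}} ( e^{∫₀ᵗ ℓ_η} φ(y*) + ∫₀ᵗ e^{∫ₛᵗ ℓ_η}
( L(s,η,η',u_{ξ*}) − u_{ξ*} ℓ_η ) ds )`, where `ℓ_η(s) = L_u(s,η(s),η'(s),u_{ξ*}(s))`;
in particular the right-hand side does not depend on the choice of `ξ*`. -/
theorem representation_formula_III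
    (n : ℕ) (hn : 1 ≤ n) (K : ℝ) (hK : 0 < K)
    (L Lu : ℝ → EuclideanSpace ℝ (Fin n) → EuclideanSpace ℝ (Fin n) → ℝ → ℝ)
    (hLC1 : ContDiff ℝ 1 fun p : ℝ × EuclideanSpace ℝ (Fin n) × EuclideanSpace ℝ (Fin n) × ℝ =>
      L p.1 p.2.1 p.2.2.1 p.2.2.2)
    (hLu : ∀ (s : ℝ) (x v : EuclideanSpace ℝ (Fin n)) (u : ℝ),
      HasDerivAt (fun r => L s x v r) (Lu s x v u) u)
    (hLuK : ∀ (s : ℝ) (x v : EuclideanSpace ℝ (Fin n)) (u : ℝ), |Lu s x v u| ≤ K)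
    (hconc : ∀ (s : ℝ) (x v : EuclideanSpace ℝ (Fin n)),
      ConcaveOn ℝ univ fun u : ℝ => L s x v u)
    (φ : EuclideanSpace ℝ (Fin n) → ℝ) (t : ℝ) (ht : 0 < t) (x : EuclideanSpace ℝ (Fin n))
    (usol : (ℝ → EuclideanSpace ℝ (Fin n)) → (ℝ → EuclideanSpace ℝ (Fin n)) → ℝ → ℝ)
    (husol : ∀ ξ ξ', IsLipCurve n 0 t ξ ξ' →
      IsCaraSol n L 0 t ξ ξ' (φ (ξ 0)) (usol ξ ξ'))
    (ξs ξs' : ℝ → EuclideanSpace ℝ (Fin n))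
    (hξs : IsLipCurve n 0 t ξs ξs' ∧ ξs t = x)
    (hmin : ∀ p : {p : (ℝ → EuclideanSpace ℝ (Fin n)) × (ℝ → EuclideanSpace ℝ (Fin n)) //
        IsLipCurve n 0 t p.1 p.2 ∧ p.1 t = x},
      usol ξs ξs' t ≤ usol p.1.1 p.1.2 t) :
    (⨅ p : {p : (ℝ → EuclideanSpace ℝ (Fin n)) × (ℝ → EuclideanSpace ℝ (Fin n)) //
        IsLipCurve n 0 t p.1 p.2 ∧ p.1 t = x},
      ((usol p.1.1 p.1.2 t : ℝ) : EReal)) =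
    ⨅ p : {p : (ℝ → EuclideanSpace ℝ (Fin n)) × (ℝ → EuclideanSpace ℝ (Fin n)) //
        IsLipCurve n 0 t p.1 p.2 ∧ p.1 0 = ξs 0 ∧ p.1 t = x},
      (((Real.exp (∫ τ in (0:ℝ)..t, Lu τ (p.1.1 τ) (p.1.2 τ) (usol ξs ξs' τ)) * φ (ξs 0) +
          ∫ s in (0:ℝ)..t,
            Real.exp (∫ τ in s..t, Lu τ (p.1.1 τ) (p.1.2 τ) (usol ξs ξs' τ)) *
              (L s (p.1.1 s) (p.1.2 s) (usol ξs ξs' s) -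
                usol ξs ξs' s * Lu s (p.1.1 s) (p.1.2 s) (usol ξs ξs' s))) : ℝ) : EReal) := by
  obtain ⟨hξc, hξt⟩ := hξs
  have hLuc := continuous_partialDeriv_last hLC1 hLu
  obtain ⟨hwc, hwi, hweq⟩ := husol ξs ξs' hξc
  have hℓ : ∀ η η', IsLipCurve n 0 t η η' →
      IntervalIntegrable (fun τ => Lu τ (η τ) (η' τ) (usol ξs ξs' τ)) volume 0 t :=
    fun η η' hη => (intervalIntegrable_const (c := K)).mono_fun
      (hη.aestronglyMeasurable_comp hLuc ht.le hwc)
      (Filter.Eventually.of_forall fun s => (hLuK _ _ _ _).trans (Real.le_norm_self _))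
  have hopt : (⨅ p : {p : (ℝ → EuclideanSpace ℝ (Fin n)) × (ℝ → EuclideanSpace ℝ (Fin n)) //
        IsLipCurve n 0 t p.1 p.2 ∧ p.1 t = x},
      ((usol p.1.1 p.1.2 t : ℝ) : EReal)) = (usol ξs ξs' t : ℝ) :=
    le_antisymm (iInf_le_of_le ⟨(ξs, ξs'), hξc, hξt⟩ le_rfl)
      (le_iInf fun p => EReal.coe_le_coe_iff.mpr (hmin p))
  rw [hopt]
  refine le_antisymm (le_iInf fun p => EReal.coe_le_coe_iff.mpr ?_)
    (iInf_le_of_le ⟨(ξs, ξs'), hξc, rfl, hξt⟩ (EReal.coe_le_coe_iff.mpr ?_))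
  · obtain ⟨⟨η, η'⟩, hη, hη0, hηt⟩ := p
    dsimp only at hη hη0 hηt ⊢
    refine (hmin ⟨(η, η'), hη, hηt⟩).trans ?_
    obtain ⟨hvc, hvi, hveq⟩ := husol η η' hη
    have hℓη := hℓ η η' hη
    have hexp := (absolutelyContinuousOnInterval_integral_left hℓη).exp.continuousOn
    have hLw := hη.intervalIntegrable_comp hLC1.continuous hLu hLuK ht.le hwc hvc hvi
    rw [← uIcc_of_le ht.le] at hwc hvc
    dsimp only
    rw [eq_exp_mul_add_integral_exp_mul ht.le hℓη hvi hveq, hη0]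
    gcongr
    refine intervalIntegral.integral_mono_on ht.le
      ((hvi.sub (hℓη.continuousOn_mul hvc)).continuousOn_mul hexp)
      ((hLw.sub (hℓη.continuousOn_mul hwc)).continuousOn_mul hexp) fun s _ => ?_
    refine mul_le_mul_of_nonneg_left ?_ (Real.exp_pos _).le
    have := (hconc s (η s) (η' s)).le_add_mul_of_hasDerivAt
      (hLu s (η s) (η' s) (usol ξs ξs' s)) (usol η η' s)
    linarith
  · exact (eq_exp_mul_add_integral_exp_mul ht.le (hℓ ξs ξs' hξc) hwi hweq).ge
end
end
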